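/- Fix T > 0, ρ ∈ (0,1), χ = ρ(1−ρ), α ∈ ℝ, and 0 < t ≤ T. For ψ ∈ C²_c(ℝ) and H ∈ C^{1,2}_c([0,T]×ℝ), define the net macroscopic current 𝒞(t; ψ, H) = ∫₀ᵗ ∫_ℝ [ −(1/2) p'_s(v) ψ(v) + χ p_{t−s}(v) ∂_v H(s,v) ] dv ds. Then the infimum of ‖ψ‖²_{L²(ℝ)}/(2χ) + (χ/2) ∫₀ᵀ∫_ℝ (∂_u H(r,u))² du dr over all ψ ∈ C²_c(ℝ) and H ∈ C^{1,2}_c([0,T]×ℝ) with 𝒞(t; ψ, H) = α equals √(2π) α² / (4χ√t). -/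

import Mathlib

open Real MeasureTheory

/-- The one-dimensional heat kernel `p_t(u) = (2πt)^{-1/2} exp(-u²/(2t))`. -/
noncomputable def heatK (t u : ℝ) : ℝ := Real.exp (-(u ^ 2) / (2 * t)) / Real.sqrt (2 * π * t)

/-- The spatial derivative of the heat kernel: `p'_t(u) = -(u/t) p_t(u)`. -/
noncomputable def heatK' (t u : ℝ) : ℝ := -(u / t) * heatK t u

/-- The net macroscopic current
`𝒞(t; ψ, H) = ∫₀ᵗ ∫_ℝ [ −(1/2) p'_s(v) ψ(v) + χ p_{t−s}(v) ∂_v H(s,v) ] dv ds`. -/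
noncomputable def netCurrent (χ t : ℝ) (ψ : ℝ → ℝ) (H : ℝ → ℝ → ℝ) : ℝ :=
  ∫ s in (0:ℝ)..t, ∫ v, (-(1/2) * heatK' s v * ψ v + χ * heatK (t - s) v * deriv (H s) v)


noncomputable def gPhi (x : ℝ) : ℝ := Real.exp (-(1/2) * x ^ 2) / Real.sqrt (2 * π)
noncomputable def gE (x : ℝ) : ℝ := ∫ y in (0:ℝ)..x, gPhi y
noncomputable def gQ (x : ℝ) : ℝ := 1 / 2 - gE x

lemma gPhi_pos (x : ℝ) : 0 < gPhi x := by unfold gPhi; positivity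

lemma gPhi_contDiff : ContDiff ℝ (⊤ : ℕ∞) gPhi := by unfold gPhi; fun_prop

lemma gPhi_cont : Continuous gPhi := gPhi_contDiff.continuous

lemma gPhi_hasDerivAt (x : ℝ) : HasDerivAt gPhi (-x * gPhi x) x := by
  unfold gPhi
  have h : HasDerivAt (fun x : ℝ => -(1/2) * x ^ 2) (-x) x := by
    have := (hasDerivAt_pow 2 x).const_mul (-(1/2) : ℝ)
    refine this.congr_deriv ?_; simp; try ring
  refine (h.exp.div_const (Real.sqrt (2 * π))).congr_deriv ?_; ring

lemma gPhi_integrable : Integrable gPhi := by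
  unfold gPhi
  exact (integrable_exp_neg_mul_sq (by norm_num : (0:ℝ) < 1/2)).div_const _

lemma gPhi_integral_Ioi : ∫ x in Set.Ioi (0:ℝ), gPhi x = 1 / 2 := by
  unfold gPhi
  rw [integral_div, integral_gaussian_Ioi]
  have : π / (1/2) = 2 * π := by ring
  rw [this]
  have : Real.sqrt (2 * π) ≠ 0 := by positivity
  field_simp

lemma gE_hasDerivAt (x : ℝ) : HasDerivAt gE (gPhi x) x :=
  intervalIntegral.integral_hasDerivAt_right (gPhi_cont.intervalIntegrable _ _)
    (gPhi_cont.stronglyMeasurableAtFilter _ _) gPhi_cont.continuousAt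

lemma gE_deriv : deriv gE = gPhi := funext fun x => (gE_hasDerivAt x).deriv

lemma gE_contDiff : ContDiff ℝ (⊤ : ℕ∞) gE := by
  rw [contDiff_infty_iff_deriv]
  exact ⟨fun x => (gE_hasDerivAt x).differentiableAt, by rw [gE_deriv]; exact gPhi_contDiff⟩

lemma gE_cont : Continuous gE := gE_contDiff.continuous

lemma gE_mono : Monotone gE := by
  apply monotone_of_deriv_nonneg (fun x => (gE_hasDerivAt x).differentiableAt)
  intro x; rw [gE_deriv]; exact (gPhi_pos x).le

lemma gE_zero : gE 0 = 0 := by simp [gE]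

lemma gPhi_neg (x : ℝ) : gPhi (-x) = gPhi x := by simp [gPhi]

lemma gE_neg (x : ℝ) : gE (-x) = - gE x := by
  unfold gE
  have := intervalIntegral.integral_comp_neg (a := 0) (b := x) gPhi
  simp only [gPhi_neg, neg_zero] at this
  rw [this, intervalIntegral.integral_symm]

lemma gE_tendsto : Filter.Tendsto gE Filter.atTop (nhds (1 / 2)) := by
  rw [← gPhi_integral_Ioi]
  exact intervalIntegral_tendsto_integral_Ioi 0 gPhi_integrable.integrableOn Filter.tendsto_id

lemma gE_le (x : ℝ) : gE x ≤ 1 / 2 := gE_mono.ge_of_tendsto gE_tendsto x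

lemma gE_abs (x : ℝ) : |gE x| ≤ 1 / 2 := by
  rw [abs_le]
  have := gE_le (-x)
  rw [gE_neg] at this
  exact ⟨by linarith, gE_le x⟩

lemma gQ_nonneg (x : ℝ) : 0 ≤ gQ x := by have := gE_le x; unfold gQ; linarith

lemma gQ_cont : Continuous gQ := by unfold gQ; exact continuous_const.sub gE_cont

lemma gQ_le (x : ℝ) (hx : 0 ≤ x) : gQ x ≤ 1 / 2 := by
  have := gE_mono hx
  rw [gE_zero] at this
  unfold gQ; linarith

lemma gQ_hasDerivAt (x : ℝ) : HasDerivAt gQ (-gPhi x) x := by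
  have := (gE_hasDerivAt x).const_sub (1/2)
  exact this

lemma gQ_tendsto : Filter.Tendsto gQ Filter.atTop (nhds 0) := by
  have := gE_tendsto.const_sub (1/2)
  rw [sub_self] at this; exact this

lemma gPhi_tendsto : Filter.Tendsto gPhi Filter.atTop (nhds 0) := by
  have h : Filter.Tendsto (fun x : ℝ => Real.exp (-(1/2) * x ^ 2)) Filter.atTop (nhds 0) := by
    apply Real.tendsto_exp_atBot.comp
    apply Filter.Tendsto.const_mul_atTop_of_neg (by norm_num)
    exact Filter.tendsto_pow_atTop (by norm_num)
  have := h.div_const (Real.sqrt (2 * π))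
  rw [zero_div] at this; exact this

lemma gQ_mul_le (x : ℝ) (hx : 0 ≤ x) : x * gQ x ≤ gPhi x := by
  -- `gPhi - x gQ` is antitone with nonnegative limit; use the integral representation instead
  have h1 : ∫ y in Set.Ioi x, gPhi y = gQ x := by
    have := integral_Ioi_of_hasDerivAt_of_tendsto' (f := gE) (f' := gPhi) (a := x) (m := 1/2)
      (fun y _ => gE_hasDerivAt y) gPhi_integrable.integrableOn gE_tendsto
    rw [this, gQ]
  have hd : ∀ y ∈ Set.Ici x, HasDerivAt (fun y => - gPhi y) (y * gPhi y) y := by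
    intro y _
    have := (gPhi_hasDerivAt y).neg
    refine this.congr_deriv ?_; ring
  have hn : ∀ y ∈ Set.Ioi x, 0 ≤ y * gPhi y := fun y hy =>
    mul_nonneg (hx.trans (le_of_lt hy)) (gPhi_pos y).le
  have hl : Filter.Tendsto (fun y => - gPhi y) Filter.atTop (nhds 0) := by
    simpa using gPhi_tendsto.neg
  have hi : IntegrableOn (fun y => y * gPhi y) (Set.Ioi x) :=
    integrableOn_Ioi_deriv_of_nonneg' hd hn hl
  have h2 := integral_Ioi_of_hasDerivAt_of_nonneg' hd hn hl
  have h3 : ∫ y in Set.Ioi x, x * gPhi y ≤ ∫ y in Set.Ioi x, y * gPhi y := by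
    apply setIntegral_mono_on (gPhi_integrable.integrableOn.const_mul x) hi measurableSet_Ioi
    intro y hy
    exact mul_le_mul_of_nonneg_right (le_of_lt hy) (gPhi_pos y).le
  rw [integral_const_mul, h1, h2] at h3
  linarith

lemma gPhi_sq (x : ℝ) : gPhi x ^ 2 = Real.exp (-1 * x ^ 2) / (2 * π) := by
  unfold gPhi
  rw [div_pow, Real.sq_sqrt (by positivity), ← Real.exp_nat_mul]
  congr 2; push_cast; ring

lemma gPhi_zero : gPhi 0 = 1 / Real.sqrt (2 * π) := by simp [gPhi]

lemma gQ_sq : IntegrableOn (fun x => gQ x ^ 2) (Set.Ioi 0) ∧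
    ∫ x in Set.Ioi (0:ℝ), gQ x ^ 2 = 1 / Real.sqrt (2 * π) - 1 / (2 * Real.sqrt π) := by
  have hd : ∀ y ∈ Set.Ici (0:ℝ), HasDerivAt (fun y => y * gQ y ^ 2 - 2 * gPhi y * gQ y)
      (gQ y ^ 2 + 2 * gPhi y ^ 2) y := by
    intro y _
    have h := ((hasDerivAt_id y).mul ((gQ_hasDerivAt y).pow 2)).sub
      (((gPhi_hasDerivAt y).const_mul 2).mul (gQ_hasDerivAt y))
    refine h.congr_deriv ?_
    simp; ring
  have hn : ∀ y ∈ Set.Ioi (0:ℝ), 0 ≤ gQ y ^ 2 + 2 * gPhi y ^ 2 := fun y _ => by positivity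
  have hl : Filter.Tendsto (fun y => y * gQ y ^ 2 - 2 * gPhi y * gQ y) Filter.atTop (nhds 0) := by
    have h1 : Filter.Tendsto (fun y => y * gQ y ^ 2) Filter.atTop (nhds 0) := by
      apply squeeze_zero' (g := fun y => gPhi y * gQ y)
      · filter_upwards [Filter.eventually_ge_atTop 0] with y hy
        positivity
      · filter_upwards [Filter.eventually_ge_atTop 0] with y hy
        have := mul_le_mul_of_nonneg_right (gQ_mul_le y hy) (gQ_nonneg y)
        linarith [this, sq (gQ y), mul_assoc y (gQ y) (gQ y)]
      · simpa using gPhi_tendsto.mul gQ_tendsto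
    have h2 := (gPhi_tendsto.const_mul 2).mul gQ_tendsto
    simpa using h1.sub h2
  have hi := integrableOn_Ioi_deriv_of_nonneg' hd hn hl
  have h2 := integral_Ioi_of_hasDerivAt_of_nonneg' hd hn hl
  have hP : IntegrableOn (fun x => 2 * gPhi x ^ 2) (Set.Ioi 0) := by
    simp only [gPhi_sq]
    exact (((integrable_exp_neg_mul_sq (by norm_num : (0:ℝ) < 1)).div_const _).const_mul 2).integrableOn
  have hPi : ∫ x in Set.Ioi (0:ℝ), 2 * gPhi x ^ 2 = 1 / (2 * Real.sqrt π) := by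
    simp only [gPhi_sq]
    rw [integral_const_mul, integral_div, integral_gaussian_Ioi]
    have : Real.sqrt π ^ 2 = π := Real.sq_sqrt pi_pos.le
    have h3 : Real.sqrt π ≠ 0 := by positivity
    have h4 := pi_ne_zero
    rw [div_one]
    field_simp
    exact this
  have hQ : IntegrableOn (fun x => gQ x ^ 2) (Set.Ioi 0) := by
    have := hi.sub hP
    refine this.congr_fun (fun x _ => ?_) measurableSet_Ioi
    simp
  refine ⟨hQ, ?_⟩
  rw [integral_add hQ hP, hPi] at h2
  simp only [gPhi_zero, gQ, gE_zero] at h2 ⊢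
  linarith

lemma heatK_nonneg (s u : ℝ) : 0 ≤ heatK s u := by unfold heatK; positivity

lemma heatK_eq (s u : ℝ) (hs : 0 < s) : heatK s u = gPhi (u / Real.sqrt s) / Real.sqrt s := by
  unfold heatK gPhi
  rw [Real.sqrt_mul (by positivity), div_pow, Real.sq_sqrt hs.le, div_div]
  congr 2; field_simp

lemma heatK_meas : Measurable (fun q : ℝ × ℝ => heatK q.1 q.2) := by
  unfold heatK; fun_prop

lemma heatK'_meas : Measurable (fun q : ℝ × ℝ => heatK' q.1 q.2) := by
  unfold heatK'
  exact (by fun_prop : Measurable fun q : ℝ × ℝ => -(q.2 / q.1)).mul heatK_meas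

lemma heatK_integrable (s : ℝ) (hs : 0 < s) : Integrable (heatK s) := by
  have : heatK s = fun u => Real.exp (-(1/(2*s)) * u ^ 2) / Real.sqrt (2 * π * s) := by
    ext u; unfold heatK; congr 2; field_simp
  rw [this]
  exact (integrable_exp_neg_mul_sq (by positivity)).div_const _

lemma heatK_integral (s : ℝ) (hs : 0 < s) : ∫ u, heatK s u = 1 := by
  have : heatK s = fun u => Real.exp (-(1/(2*s)) * u ^ 2) / Real.sqrt (2 * π * s) := by
    ext u; unfold heatK; congr 2; field_simp
  rw [this, integral_div, integral_gaussian]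
  have : π / (1 / (2 * s)) = 2 * π * s := by field_simp
  rw [this]
  exact div_self (by positivity)

lemma heatK_sq_eq (s : ℝ) (hs : 0 < s) : (fun u => heatK s u ^ 2) =
    fun u => Real.exp (-(1/s) * u ^ 2) / (2 * π * s) := by
  ext u; unfold heatK
  rw [div_pow, Real.sq_sqrt (by positivity), ← Real.exp_nat_mul]
  congr 2; push_cast; field_simp

lemma heatK_sq_integrable (s : ℝ) (hs : 0 < s) : Integrable (fun u => heatK s u ^ 2) := by
  rw [heatK_sq_eq s hs]
  exact (integrable_exp_neg_mul_sq (by positivity)).div_const _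

lemma heatK_sq_integral (s : ℝ) (hs : 0 < s) :
    ∫ u, heatK s u ^ 2 = (1 / (2 * Real.sqrt π)) * s ^ (-(1/2) : ℝ) := by
  rw [heatK_sq_eq s hs, integral_div, integral_gaussian, Real.rpow_neg hs.le, ← Real.sqrt_eq_rpow]
  have : π / (1 / s) = π * s := by field_simp
  rw [this, Real.sqrt_mul pi_pos.le]
  have h1 : Real.sqrt π ≠ 0 := by positivity
  have h2 : Real.sqrt s ≠ 0 := by positivity
  have h3 : Real.sqrt π ^ 2 = π := Real.sq_sqrt pi_pos.le
  have h4 : Real.sqrt s ^ 2 = s := Real.sq_sqrt hs.le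
  field_simp
  rw [h3, h4]

lemma rpow_ii (t : ℝ) : IntervalIntegrable (fun s : ℝ => s ^ (-(1/2) : ℝ)) volume 0 t :=
  intervalIntegral.intervalIntegrable_rpow' (by norm_num)

/-- The norm of the heat kernel part. -/
lemma Kp_ii (t : ℝ) (ht : 0 < t) :
    IntervalIntegrable (fun s => ∫ u, heatK (t - s) u ^ 2) volume 0 t ∧
    ∫ s in (0:ℝ)..t, ∫ u, heatK (t - s) u ^ 2 = Real.sqrt t / Real.sqrt π := by
  have hii := (rpow_ii t).const_mul (1 / (2 * Real.sqrt π))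
  have hA : IntervalIntegrable (fun s => ∫ u, heatK s u ^ 2) volume 0 t := by
    refine hii.congr (fun s hs => ?_)
    rw [Set.uIoc_of_le ht.le] at hs
    exact (heatK_sq_integral s hs.1).symm
  constructor
  · have := hA.comp_sub_left t
    simp only [sub_zero, sub_self] at this
    exact this.symm
  · rw [intervalIntegral.integral_comp_sub_left (fun s => ∫ u, heatK s u ^ 2) t]
    simp only [sub_zero, sub_self]
    have : ∫ s in (0:ℝ)..t, ∫ u, heatK s u ^ 2 =
        ∫ s in (0:ℝ)..t, (1 / (2 * Real.sqrt π)) * s ^ (-(1/2) : ℝ) := by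
      apply intervalIntegral.integral_congr_ae
      filter_upwards with s hs
      rw [Set.uIoc_of_le ht.le] at hs
      exact heatK_sq_integral s hs.1
    rw [this, intervalIntegral.integral_const_mul, integral_rpow (by norm_num)]
    rw [show (-(1/2) + 1 : ℝ) = 1/2 by norm_num, Real.zero_rpow (by norm_num),
      ← Real.sqrt_eq_rpow]
    field_simp
    ring

lemma heatK'_bound (s u : ℝ) (hs : 0 < s) :
    |heatK' s u| ≤ s ^ (-(1/2) : ℝ) * (Real.sqrt 2 * heatK (2 * s) u) := by
  rw [Real.rpow_neg hs.le, ← Real.sqrt_eq_rpow, heatK', abs_mul, abs_neg,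
    abs_of_nonneg (heatK_nonneg s u), abs_div, abs_of_pos hs]
  have hr : 0 < Real.sqrt s := Real.sqrt_pos.2 hs
  have hr2 : Real.sqrt s ^ 2 = s := Real.sq_sqrt hs.le
  set x := |u| / Real.sqrt s with hx
  have h1 : |u| / s = (Real.sqrt s)⁻¹ * x := by
    rw [hx]; nth_rewrite 1 [← hr2]; field_simp
  have h2 : x ≤ Real.exp (x ^ 2 / 4) := by
    have := Real.add_one_le_exp (x ^ 2 / 4)
    nlinarith [sq_nonneg (x - 2)]
  have hx2 : x ^ 2 = u ^ 2 / s := by rw [hx, div_pow, hr2, sq_abs]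
  have h3 : heatK s u = Real.sqrt 2 * heatK (2 * s) u * Real.exp (-(x ^ 2 / 4)) := by
    unfold heatK
    rw [show 2 * π * (2 * s) = 2 * (2 * π * s) by ring, Real.sqrt_mul (by norm_num) (2 * π * s), hx2]
    have e : Real.exp (-u ^ 2 / (2 * s)) = Real.exp (-u ^ 2 / (2 * (2 * s))) * Real.exp (-(u ^ 2 / s / 4)) := by
      rw [← Real.exp_add]; congr 1; field_simp; ring
    have : Real.sqrt (2 * π * s) ≠ 0 := by positivity
    have : Real.sqrt 2 ≠ 0 := by positivity
    rw [e]
    field_simp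
  rw [h1, h3, mul_assoc]
  apply mul_le_mul_of_nonneg_left _ (by positivity)
  have h4 : x * Real.exp (-(x ^ 2 / 4)) ≤ 1 := by
    rw [Real.exp_neg, ← div_eq_mul_inv, div_le_one (Real.exp_pos _)]; exact h2
  have h5 : 0 ≤ Real.sqrt 2 * heatK (2 * s) u := mul_nonneg (by positivity) (heatK_nonneg _ _)
  nlinarith

lemma heatK'_integrable (s : ℝ) (hs : 0 < s) : Integrable (heatK' s) := by
  refine Integrable.mono' (((heatK_integrable (2 * s) (by positivity)).const_mul (Real.sqrt 2)).const_mul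
    (s ^ (-(1/2) : ℝ))) ?_ ?_
  · exact (heatK'_meas.comp (measurable_const.prodMk measurable_id : Measurable fun u : ℝ => (s, u))).aestronglyMeasurable
  · filter_upwards with u
    exact heatK'_bound s u hs

lemma heatK'_prod (t : ℝ) (ht : 0 < t) : Integrable (fun q : ℝ × ℝ => heatK' q.1 q.2)
    ((volume.restrict (Set.Ioc 0 t)).prod volume) := by
  rw [integrable_prod_iff heatK'_meas.aestronglyMeasurable]
  constructor
  · filter_upwards [ae_restrict_mem measurableSet_Ioc] with s hs
    exact heatK'_integrable s hs.1
  · have hii := (intervalIntegrable_iff_integrableOn_Ioc_of_le ht.le).1 ((rpow_ii t).mul_const (Real.sqrt 2))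
    refine Integrable.mono' hii ?_ ?_
    · exact (heatK'_meas.norm.stronglyMeasurable.integral_prod_right
        (ν := volume)).aestronglyMeasurable
    · filter_upwards [ae_restrict_mem measurableSet_Ioc] with s hs
      rw [Real.norm_of_nonneg (integral_nonneg fun _ => norm_nonneg _)]
      have hi := (((heatK_integrable (2 * s) (by linarith [hs.1])).const_mul (Real.sqrt 2)).const_mul
        (s ^ (-(1/2) : ℝ)))
      refine (integral_mono (heatK'_integrable s hs.1).norm hi (fun u => heatK'_bound s u hs.1)).trans ?_
      rw [integral_const_mul, integral_const_mul, heatK_integral _ (by linarith [hs.1]), mul_one]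

/-- `g(v) = P(B_t > v)` for `v > 0`, odd. -/
noncomputable def gG (t v : ℝ) : ℝ := (if 0 ≤ v then 1 else -1) * gQ (|v| / Real.sqrt t)

lemma gG_abs (t v : ℝ) : |gG t v| = gQ (|v| / Real.sqrt t) := by
  unfold gG
  rw [abs_mul, abs_of_nonneg (gQ_nonneg _)]
  split_ifs <;> simp

lemma gG_meas (t : ℝ) : Measurable (gG t) := by
  unfold gG
  refine Measurable.mul (Measurable.ite measurableSet_Ici measurable_const measurable_const) ?_
  exact gQ_cont.measurable.comp (by fun_prop)

lemma gG_sq_eq (t v : ℝ) : gG t v ^ 2 = gQ (|v| / Real.sqrt t) ^ 2 := by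
  rw [← gG_abs, sq_abs]

lemma gG_sq_integral (t : ℝ) (ht : 0 < t) :
    ∫ v, gG t v ^ 2 = 2 * Real.sqrt t * (1 / Real.sqrt (2 * π) - 1 / (2 * Real.sqrt π)) := by
  simp only [gG_sq_eq]
  have := integral_comp_abs (f := fun v => gQ (v / Real.sqrt t) ^ 2)
  rw [this]
  have h2 := integral_comp_mul_right_Ioi (fun v => gQ v ^ 2) 0 (b := (Real.sqrt t)⁻¹) (by positivity)
  simp only [← div_eq_mul_inv] at h2
  rw [h2, zero_div, gQ_sq.2]
  simp only [inv_inv, smul_eq_mul]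
  ring

lemma gG_sq_integrable (t : ℝ) (ht : 0 < t) : Integrable (fun v => gG t v ^ 2) := by
  apply Integrable.of_integral_ne_zero
  rw [gG_sq_integral t ht]
  have h1 : Real.sqrt (2 * π) < 2 * Real.sqrt π := by
    rw [Real.sqrt_lt' (by positivity), mul_pow, Real.sq_sqrt pi_pos.le]
    linarith [pi_pos]
  have h2 : 1 / (2 * Real.sqrt π) < 1 / Real.sqrt (2 * π) :=
    one_div_lt_one_div_of_lt (by positivity) h1
  have : 0 < 1 / Real.sqrt (2 * π) - 1 / (2 * Real.sqrt π) := by linarith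
  positivity

lemma gG_eq_integral (t v : ℝ) (ht : 0 < t) (hv : v ≠ 0)
    (hInt0 : IntervalIntegrable (fun s => -(1/2) * heatK' s v) volume 0 t) :
    ∫ s in (0:ℝ)..t, -(1/2) * heatK' s v = gG t v := by
  have hd : ∀ s ∈ Set.Ioi (0:ℝ), HasDerivAt (fun s => - gE (v / Real.sqrt s)) (-(1/2) * heatK' s v) s := by
    intro s hs
    have hs : 0 < s := hs
    have hr : 0 < Real.sqrt s := Real.sqrt_pos.2 hs
    have h1 : HasDerivAt (fun s => v / Real.sqrt s) (-(v * (1 / (2 * Real.sqrt s))) / Real.sqrt s ^ 2) s := by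
      have := (hasDerivAt_const s v).div (Real.hasDerivAt_sqrt hs.ne') hr.ne'
      refine this.congr_deriv ?_
      simp
    have h2 := ((gE_hasDerivAt (v / Real.sqrt s)).comp s h1).neg
    refine h2.congr_deriv ?_
    rw [heatK', heatK_eq s v hs, Real.sq_sqrt hs.le]
    field_simp
  have hb : Filter.Tendsto (fun s => - gE (v / Real.sqrt s)) (nhdsWithin t (Set.Iio t))
      (nhds (- gE (v / Real.sqrt t))) :=
    (hd t ht).continuousAt.continuousWithinAt
  have hsq : Filter.Tendsto (fun s : ℝ => (Real.sqrt s)⁻¹) (nhdsWithin 0 (Set.Ioi 0)) Filter.atTop := by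
    apply Filter.Tendsto.inv_tendsto_nhdsGT_zero
    apply tendsto_nhdsWithin_iff.2 ⟨?_, ?_⟩
    · have := Real.continuous_sqrt.tendsto 0
      rw [Real.sqrt_zero] at this
      exact this.mono_left nhdsWithin_le_nhds
    · filter_upwards [self_mem_nhdsWithin] with s hs
      exact Real.sqrt_pos.2 hs
  rcases lt_or_gt_of_ne hv with h | h
  · have ha : Filter.Tendsto (fun s => - gE (v / Real.sqrt s)) (nhdsWithin 0 (Set.Ioi 0)) (nhds (1/2)) := by
      have h1 := gE_tendsto.comp (hsq.const_mul_atTop (by linarith : 0 < -v))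
      refine h1.congr (fun s => ?_)
      simp only [Function.comp]
      rw [← gE_neg]; congr 1; ring
    rw [intervalIntegral.integral_eq_sub_of_hasDerivAt_of_tendsto ht (fun s hs => hd s hs.1) hInt0 ha hb]
    simp only [gG, if_neg (not_le.2 h), abs_of_neg h, gQ, neg_div, gE_neg]
    ring
  · have ha : Filter.Tendsto (fun s => - gE (v / Real.sqrt s)) (nhdsWithin 0 (Set.Ioi 0)) (nhds (-(1/2))) := by
      have h1 := (gE_tendsto.comp (hsq.const_mul_atTop h)).neg
      exact h1
    rw [intervalIntegral.integral_eq_sub_of_hasDerivAt_of_tendsto ht (fun s hs => hd s hs.1) hInt0 ha hb]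
    simp only [gG, if_pos h.le, abs_of_pos h, gQ]
    ring

lemma int_mul_bdd {X : Type*} [MeasurableSpace X] {μ : Measure X} {f g : X → ℝ} {M : ℝ}
    (hf : Integrable f μ) (hg : AEStronglyMeasurable g μ) (hM : ∀ x, |g x| ≤ M) :
    Integrable (fun x => f x * g x) μ := by
  refine Integrable.mono' (hf.norm.mul_const M) (hf.aestronglyMeasurable.mul hg) ?_
  filter_upwards with x
  rw [norm_mul]
  exact mul_le_mul_of_nonneg_left (hM x) (norm_nonneg _)

lemma psi_part (t M : ℝ) (ht : 0 < t) (ψ : ℝ → ℝ) (hψ : Continuous ψ) (hM : ∀ x, |ψ x| ≤ M) :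
    IntervalIntegrable (fun s => ∫ v, -(1/2) * heatK' s v * ψ v) volume 0 t ∧
    ∫ s in (0:ℝ)..t, ∫ v, -(1/2) * heatK' s v * ψ v = ∫ v, gG t v * ψ v := by
  have h0 := (heatK'_prod t ht).const_mul (-(1/2))
  have h1 : Integrable (fun q : ℝ × ℝ => -(1/2) * heatK' q.1 q.2 * ψ q.2)
      ((volume.restrict (Set.Ioc 0 t)).prod volume) :=
    int_mul_bdd h0 (hψ.comp continuous_snd).aestronglyMeasurable (fun x => hM x.2)
  constructor
  · rw [intervalIntegrable_iff_integrableOn_Ioc_of_le ht.le]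
    exact h1.integral_prod_left
  · rw [intervalIntegral.integral_of_le ht.le]
    rw [integral_integral_swap (f := fun s v => -(1/2) * heatK' s v * ψ v) h1]
    apply integral_congr_ae
    have hne : ∀ᵐ v : ℝ, v ≠ 0 := by
      simp [ae_iff, measure_singleton]
    filter_upwards [h0.prod_left_ae, hne] with v hv hv0
    rw [integral_mul_const, ← intervalIntegral.integral_of_le ht.le, gG_eq_integral t v ht hv0]
    rw [intervalIntegrable_iff_integrableOn_Ioc_of_le ht.le]
    exact hv

lemma D_part (t M : ℝ) (ht : 0 < t) (D : ℝ → ℝ → ℝ) (hD : Continuous fun q : ℝ × ℝ => D q.1 q.2)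
    (hM : ∀ s v, |D s v| ≤ M) :
    (∀ s < t, Integrable (fun v => heatK (t - s) v * D s v)) ∧
    IntervalIntegrable (fun s => ∫ v, heatK (t - s) v * D s v) volume 0 t := by
  have hi : ∀ s < t, Integrable (fun v => heatK (t - s) v * D s v) := fun s hs =>
    int_mul_bdd (heatK_integrable (t - s) (by linarith))
      (hD.comp (Continuous.prodMk_right s)).aestronglyMeasurable (hM s)
  refine ⟨hi, ?_⟩
  have hm : Measurable (fun q : ℝ × ℝ => heatK (t - q.1) q.2 * D q.1 q.2) :=
    (heatK_meas.comp (by fun_prop : Measurable fun q : ℝ × ℝ => (t - q.1, q.2))).mul hD.measurable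
  rw [intervalIntegrable_iff_integrableOn_Ioo_of_le ht.le]
  refine Integrable.mono' (g := fun _ => M) (by simp) ?_ ?_
  · exact (hm.stronglyMeasurable.integral_prod_right (ν := volume)).aestronglyMeasurable
  · filter_upwards [ae_restrict_mem measurableSet_Ioo] with s hs
    have hp : 0 < t - s := by linarith [hs.2]
    refine (norm_integral_le_integral_norm _).trans ?_
    refine (integral_mono (hi s hs.2).norm ((heatK_integrable (t - s) hp).mul_const M) ?_).trans ?_
    · intro v
      simp only [norm_mul, Real.norm_eq_abs]
      rw [abs_of_nonneg (heatK_nonneg _ _)]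
      exact mul_le_mul_of_nonneg_left (hM s v) (heatK_nonneg _ _)
    · rw [integral_mul_const, heatK_integral _ hp, one_mul]

lemma netCurrent_eq (χ t : ℝ) (ht : 0 < t) (ψ : ℝ → ℝ) (H : ℝ → ℝ → ℝ) (M M' : ℝ)
    (hψ : Continuous ψ) (hM : ∀ x, |ψ x| ≤ M)
    (hD : Continuous fun q : ℝ × ℝ => deriv (H q.1) q.2)
    (hM' : ∀ s v, |deriv (H s) v| ≤ M') :
    netCurrent χ t ψ H = (∫ v, gG t v * ψ v) +
      χ * ∫ s in (0:ℝ)..t, ∫ v, heatK (t - s) v * deriv (H s) v := by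
  obtain ⟨a1, a2⟩ := psi_part t M ht ψ hψ hM
  obtain ⟨b1, b2⟩ := D_part t M' ht (fun s v => deriv (H s) v) hD hM'
  unfold netCurrent
  rw [← a2, ← intervalIntegral.integral_const_mul, ← intervalIntegral.integral_add a1 (b2.const_mul χ)]
  apply intervalIntegral.integral_congr_ae
  have hne : ∀ᵐ v : ℝ, v ≠ t := by
    simp [ae_iff, measure_singleton]
  filter_upwards [hne] with s hs1 hs
  rw [Set.uIoc_of_le ht.le] at hs
  have hst : s < t := lt_of_le_of_ne hs.2 hs1
  rw [← integral_const_mul, ← integral_add]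
  · congr 1; ext v; ring
  · exact int_mul_bdd ((heatK'_integrable s hs.1).const_mul _) hψ.aestronglyMeasurable hM
  · exact (b1 s hst).const_mul χ

/-- Admissible pairs. -/
def Adm (ψ : ℝ → ℝ) (H : ℝ → ℝ → ℝ) : Prop :=
  ContDiff ℝ 2 ψ ∧ HasCompactSupport ψ ∧
        (∀ u, ContDiff ℝ 1 fun r => H r u) ∧
        (∀ r, ContDiff ℝ 2 fun u => H r u) ∧
        (Continuous fun q : ℝ × ℝ => deriv (fun r => H r q.2) q.1) ∧
        (Continuous fun q : ℝ × ℝ => deriv (H q.1) q.2) ∧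
        (Continuous fun q : ℝ × ℝ => deriv (deriv (H q.1)) q.2) ∧
        (Continuous fun q : ℝ × ℝ => H q.1 q.2) ∧
        (HasCompactSupport fun q : ℝ × ℝ => H q.1 q.2)

lemma deriv_supp (H : ℝ → ℝ → ℝ) (hH : HasCompactSupport fun q : ℝ × ℝ => H q.1 q.2) :
    HasCompactSupport fun q : ℝ × ℝ => deriv (H q.1) q.2 := by
  refine hH.mono' ?_
  intro q hq
  by_contra hn
  apply hq
  have h1 : (fun q : ℝ × ℝ => H q.1 q.2) =ᶠ[nhds q] 0 := notMem_tsupport_iff_eventuallyEq.1 hn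
  have h2 : Filter.Tendsto (fun v : ℝ => (q.1, v)) (nhds q.2) (nhds q) :=
    (Continuous.prodMk_right q.1).tendsto q.2
  have h3 : H q.1 =ᶠ[nhds q.2] fun _ => 0 := h2.eventually h1
  show deriv (H q.1) q.2 = 0
  rw [h3.deriv_eq]; simp

lemma gG_bdd (t v : ℝ) : |gG t v| ≤ 1 / 2 := by
  rw [gG_abs]; exact gQ_le _ (by positivity)

lemma Adm.current {ψ : ℝ → ℝ} {H : ℝ → ℝ → ℝ} (h : Adm ψ H) (χ t : ℝ) (ht : 0 < t) :
    netCurrent χ t ψ H = (∫ v, gG t v * ψ v) +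
      χ * ∫ s in (0:ℝ)..t, ∫ v, heatK (t - s) v * deriv (H s) v := by
  obtain ⟨h1, h2, h3, h4, h5, h6, h7, h8, h9⟩ := h
  obtain ⟨M, hM⟩ := h2.exists_bound_of_continuous h1.continuous
  obtain ⟨M', hM'⟩ := (deriv_supp H h9).exists_bound_of_continuous h6
  exact netCurrent_eq χ t ht ψ H M M' h1.continuous hM h6 (fun s v => hM' (s, v))

lemma supp_sq {X : Type*} [TopologicalSpace X] {f : X → ℝ} (hf : HasCompactSupport f) :
    HasCompactSupport (fun x => f x ^ 2) := by
  refine hf.mono (fun x hx h0 => hx ?_)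
  simp only [h0]
  norm_num

lemma Adm.lower {ψ : ℝ → ℝ} {H : ℝ → ℝ → ℝ} (h : Adm ψ H) (χ t T c : ℝ) (hχ : 0 < χ) (ht : 0 < t)
    (htT : t ≤ T) :
    c * netCurrent χ t ψ H - c ^ 2 * χ / 2 *
      ((∫ v, gG t v ^ 2) + ∫ s in (0:ℝ)..t, ∫ u, heatK (t - s) u ^ 2) ≤
    (∫ u, (ψ u) ^ 2) / (2 * χ) + (χ / 2) * ∫ r in (0:ℝ)..T, ∫ u, (deriv (H r) u) ^ 2 := by
  rw [h.current χ t ht]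
  obtain ⟨h1, h2, h3, h4, h5, h6, h7, h8, h9⟩ := h
  have hs := deriv_supp H h9
  obtain ⟨M', hM'⟩ := hs.exists_bound_of_continuous h6
  obtain ⟨b1, b2⟩ := D_part t M' ht (fun s v => deriv (H s) v) h6 (fun s v => hM' (s, v))
  -- the `ψ` part
  have iψ : Integrable ψ := h1.continuous.integrable_of_hasCompactSupport h2
  have iψ2 : Integrable (fun u => ψ u ^ 2) :=
    (h1.continuous.pow 2).integrable_of_hasCompactSupport (supp_sq h2)
  have igψ : Integrable (fun u => gG t u * ψ u) := by
    have := int_mul_bdd iψ (gG_meas t).aestronglyMeasurable (gG_bdd t)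
    simpa only [mul_comm] using this
  have ig := gG_sq_integrable t ht
  have A : 2 * c * χ * (∫ u, gG t u * ψ u) - c ^ 2 * χ ^ 2 * (∫ u, gG t u ^ 2) ≤ ∫ u, ψ u ^ 2 := by
    rw [← integral_const_mul, ← integral_const_mul, ← integral_sub (igψ.const_mul _) (ig.const_mul _)]
    refine integral_mono ((igψ.const_mul _).sub (ig.const_mul _)) iψ2 (fun u => ?_)
    simp only [Pi.sub_apply]
    nlinarith [sq_nonneg (ψ u - c * χ * gG t u)]
  -- the `H` part
  have iD2 : Integrable (fun q : ℝ × ℝ => deriv (H q.1) q.2 ^ 2) (volume.prod volume) :=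
    (h6.pow 2).integrable_of_hasCompactSupport (supp_sq hs)
  have iI : Integrable (fun s => ∫ u, deriv (H s) u ^ 2) := iD2.integral_prod_left
  have B1 : ∫ r in (0:ℝ)..t, ∫ u, (deriv (H r) u) ^ 2 ≤ ∫ r in (0:ℝ)..T, ∫ u, (deriv (H r) u) ^ 2 := by
    refine intervalIntegral.integral_mono_interval le_rfl ht.le htT ?_ iI.intervalIntegrable
    filter_upwards with s
    exact integral_nonneg (fun u => sq_nonneg _)
  obtain ⟨k1, -⟩ := Kp_ii t ht
  have B2 : 2 * c * (∫ s in (0:ℝ)..t, ∫ v, heatK (t - s) v * deriv (H s) v) -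
      c ^ 2 * (∫ s in (0:ℝ)..t, ∫ u, heatK (t - s) u ^ 2) ≤
      ∫ r in (0:ℝ)..t, ∫ u, (deriv (H r) u) ^ 2 := by
    rw [← intervalIntegral.integral_const_mul, ← intervalIntegral.integral_const_mul,
      ← intervalIntegral.integral_sub (b2.const_mul _) (k1.const_mul _)]
    refine intervalIntegral.integral_mono_ae_restrict ht.le ((b2.const_mul _).sub (k1.const_mul _))
      iI.intervalIntegrable ?_
    have hne : ∀ᵐ v : ℝ ∂(volume.restrict (Set.Icc 0 t)), v ≠ t :=
      ae_restrict_of_ae (by simp [ae_iff, measure_singleton])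
    filter_upwards [hne, ae_restrict_mem measurableSet_Icc, ae_restrict_of_ae iD2.prod_right_ae]
      with s hs1 hs2 hs3
    have hst : s < t := lt_of_le_of_ne hs2.2 hs1
    have k2 := heatK_sq_integrable (t - s) (by linarith)
    rw [← integral_const_mul, ← integral_const_mul, ← integral_sub ((b1 s hst).const_mul _) (k2.const_mul _)]
    refine integral_mono (((b1 s hst).const_mul _).sub (k2.const_mul _)) hs3 (fun u => ?_)
    simp only [Pi.sub_apply]
    nlinarith [sq_nonneg (deriv (H s) u - c * heatK (t - s) u)]
  generalize (∫ u, gG t u * ψ u) = a at *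
  generalize (∫ u, gG t u ^ 2) = b at *
  generalize (∫ u, ψ u ^ 2) = d at *
  have A' : c * a - c ^ 2 * χ / 2 * b ≤ d / (2 * χ) := by
    rw [le_div_iff₀ (by positivity)]
    calc _ = 2 * c * χ * a - c ^ 2 * χ ^ 2 * b := by ring
      _ ≤ d := A
  have B3 := mul_le_mul_of_nonneg_left (B2.trans B1) (by positivity : 0 ≤ χ / 2)
  linarith

lemma exists_cut : ∃ (κ : ℝ → ℝ) (C : ℝ), ContDiff ℝ (⊤ : ℕ∞) κ ∧ (∀ x, 0 ≤ κ x ∧ κ x ≤ 1) ∧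
    (∀ x, |x| ≤ 1 → κ x = 1) ∧ (∀ x, 2 ≤ |x| → κ x = 0) ∧ 0 ≤ C ∧ (∀ x, |deriv κ x| ≤ C) ∧
    (∀ x, 2 < |x| → deriv κ x = 0) := by
  let f : ContDiffBump (0 : ℝ) := ⟨1, 2, by norm_num, by norm_num⟩
  have hz : ∀ x : ℝ, 2 ≤ |x| → f x = 0 := fun x hx =>
    f.zero_of_le_dist (by rw [Real.dist_eq, sub_zero]; exact hx)
  have hc : Continuous (deriv f) := (f.contDiff (n := 1)).continuous_deriv le_rfl
  obtain ⟨C, hC⟩ := f.hasCompactSupport.deriv.exists_bound_of_continuous hc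
  refine ⟨f, C, f.contDiff, fun x => ⟨f.nonneg, f.le_one⟩, ?_, hz, (norm_nonneg _).trans (hC 0), hC, ?_⟩
  · intro x hx
    apply f.one_of_mem_closedBall
    rw [Metric.mem_closedBall, Real.dist_eq, sub_zero]; exact hx
  · intro x hx
    have : (f : ℝ → ℝ) =ᶠ[nhds x] fun _ => 0 := by
      filter_upwards [continuous_abs.continuousAt.eventually (lt_mem_nhds hx)] with y hy
      exact hz y (le_of_lt hy)
    rw [this.deriv_eq]; simp

lemma exists_theta (t δ : ℝ) (hδ : 0 < δ) (hδt : 4 * δ < t) : ∃ θ : ℝ → ℝ, ContDiff ℝ (⊤ : ℕ∞) θ ∧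
    (∀ x, 0 ≤ θ x ∧ θ x ≤ 1) ∧ (∀ s, 2 * δ ≤ s → s ≤ t - 2 * δ → θ s = 1) ∧
    (∀ s, s ≤ δ → θ s = 0) ∧ (∀ s, t - δ ≤ s → θ s = 0) := by
  let f : ContDiffBump (t / 2 : ℝ) := ⟨t / 2 - 2 * δ, t / 2 - δ, by linarith, by linarith⟩
  refine ⟨f, f.contDiff, fun x => ⟨f.nonneg, f.le_one⟩, ?_, ?_, ?_⟩
  · intro s h1 h2
    apply f.one_of_mem_closedBall
    rw [Metric.mem_closedBall, Real.dist_eq, abs_le]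
    show -(t / 2 - 2 * δ) ≤ _ ∧ _ ≤ t / 2 - 2 * δ
    constructor <;> linarith
  · intro s hs
    apply f.zero_of_le_dist
    rw [Real.dist_eq, le_abs]
    show t / 2 - δ ≤ _ ∨ t / 2 - δ ≤ _
    right; linarith
  · intro s hs
    apply f.zero_of_le_dist
    rw [Real.dist_eq, le_abs]
    show t / 2 - δ ≤ _ ∨ t / 2 - δ ≤ _
    left; linarith

lemma partial_snd (F : ℝ × ℝ → ℝ) (hF : ContDiff ℝ (⊤ : ℕ∞) F) (r u : ℝ) :
    deriv (fun u => F (r, u)) u = fderiv ℝ F (r, u) (0, 1) := by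
  have h1 := (hF.differentiable (by simp)) (r, u)
  have h2 : HasDerivAt (fun u : ℝ => (r, u)) (0, 1) u := (hasDerivAt_const u r).prodMk (hasDerivAt_id u)
  exact (h1.hasFDerivAt.comp_hasDerivAt u h2).deriv

lemma partial_fst (F : ℝ × ℝ → ℝ) (hF : ContDiff ℝ (⊤ : ℕ∞) F) (r u : ℝ) :
    deriv (fun r => F (r, u)) r = fderiv ℝ F (r, u) (1, 0) := by
  have h1 := (hF.differentiable (by simp)) (r, u)
  have h2 : HasDerivAt (fun r : ℝ => (r, u)) (1, 0) r := (hasDerivAt_id r).prodMk (hasDerivAt_const r u)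
  exact (h1.hasFDerivAt.comp_hasDerivAt r h2).deriv

lemma adm_of_contDiff (ψ : ℝ → ℝ) (hψ : ContDiff ℝ (⊤ : ℕ∞) ψ) (hs : HasCompactSupport ψ)
    (F : ℝ × ℝ → ℝ) (hF : ContDiff ℝ (⊤ : ℕ∞) F) (hFs : HasCompactSupport F) :
    Adm ψ (fun r u => F (r, u)) := by
  have hle : ∀ n : ℕ, ((n : ℕ∞) : WithTop ℕ∞) ≤ ((⊤ : ℕ∞) : WithTop ℕ∞) := fun n => by
    exact_mod_cast le_top
  have hfd : ContDiff ℝ (⊤ : ℕ∞) (fderiv ℝ F) := hF.fderiv_right (by simp)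
  have hG : ContDiff ℝ (⊤ : ℕ∞) (fun q => fderiv ℝ F q (0, 1)) := hfd.clm_apply contDiff_const
  have hG' : ContDiff ℝ (⊤ : ℕ∞) (fun q => fderiv ℝ F q (1, 0)) := hfd.clm_apply contDiff_const
  have hGd : ContDiff ℝ (⊤ : ℕ∞) (fun q => fderiv ℝ (fun q => fderiv ℝ F q (0, 1)) q (0, 1)) :=
    (hG.fderiv_right (m := (⊤ : ℕ∞)) (by simp)).clm_apply contDiff_const
  refine ⟨hψ.of_le (hle 2), hs, fun u => ?_, fun r => ?_, ?_, ?_, ?_, hF.continuous, hFs⟩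
  · exact (hF.of_le (hle 1)).comp (contDiff_id.prodMk contDiff_const)
  · exact (hF.of_le (hle 2)).comp (contDiff_const.prodMk contDiff_id)
  · have : (fun q : ℝ × ℝ => deriv (fun r => F (r, q.2)) q.1) = fun q => fderiv ℝ F q (1, 0) := by
      ext q; exact partial_fst F hF q.1 q.2
    rw [this]; exact hG'.continuous
  · have : (fun q : ℝ × ℝ => deriv (fun u => F (q.1, u)) q.2) = fun q => fderiv ℝ F q (0, 1) := by
      ext q; exact partial_snd F hF q.1 q.2
    rw [this]; exact hG.continuous
  · have : (fun q : ℝ × ℝ => deriv (deriv (fun u => F (q.1, u))) q.2) =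
        fun q => fderiv ℝ (fun q => fderiv ℝ F q (0, 1)) q (0, 1) := by
      ext q
      have h1 : deriv (fun u => F (q.1, u)) = fun u => (fun q => fderiv ℝ F q (0, 1)) (q.1, u) := by
        ext u; exact partial_snd F hF q.1 u
      rw [h1]
      exact partial_snd _ hG q.1 q.2
    rw [this]; exact hGd.continuous

/-- approximating `ψ` -/
noncomputable def aPsi (κ : ℝ → ℝ) (t : ℝ) (n : ℕ) (v : ℝ) : ℝ :=
  (gE ((n + 1 / Real.sqrt t) * v) - gE (v / Real.sqrt t)) * κ (v / (n + 1))

/-- approximating `H` -/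
noncomputable def aH (κ θ : ℝ → ℝ) (t : ℝ) (n : ℕ) (q : ℝ × ℝ) : ℝ :=
  θ q.1 * (gE (q.2 / Real.sqrt (t - q.1)) * κ (q.2 / (n + 1)))

lemma gE_diff_le (t m v : ℝ) (hm : 1 / Real.sqrt t ≤ m) :
    |gE (m * v) - gE (v / Real.sqrt t)| ≤ gQ (|v| / Real.sqrt t) := by
  have key : ∀ v, 0 ≤ v → |gE (m * v) - gE (v / Real.sqrt t)| ≤ gQ (|v| / Real.sqrt t) := by
    intro v hv
    have h1 : v / Real.sqrt t ≤ m * v := by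
      have := mul_le_mul_of_nonneg_right hm hv
      calc v / Real.sqrt t = 1 / Real.sqrt t * v := by ring
        _ ≤ _ := this
    have h2 := gE_mono h1
    rw [abs_of_nonneg (by linarith), abs_of_nonneg hv, gQ]
    linarith [gE_le (m * v)]
  rcases le_total 0 v with h | h
  · exact key v h
  · have := key (-v) (by linarith)
    rw [mul_neg, neg_div, gE_neg, gE_neg, abs_neg, ← abs_neg] at this
    convert this using 2
    ring

lemma aPsi_contDiff (κ : ℝ → ℝ) (hκ : ContDiff ℝ (⊤ : ℕ∞) κ) (t : ℝ) (n : ℕ) :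
    ContDiff ℝ (⊤ : ℕ∞) (aPsi κ t n) := by
  unfold aPsi
  refine ContDiff.mul (ContDiff.sub (gE_contDiff.comp ?_) (gE_contDiff.comp ?_)) (hκ.comp ?_)
  · fun_prop
  · fun_prop
  · fun_prop

lemma cut_zero (κ : ℝ → ℝ) (h2 : ∀ x, 2 ≤ |x| → κ x = 0) (n : ℕ) (v : ℝ)
    (hv : v ∉ Set.Icc (-(2 * ((n:ℝ) + 1))) (2 * ((n:ℝ) + 1))) : 2 < |v / ((n:ℝ) + 1)| := by
  have hn : (0:ℝ) < (n:ℝ) + 1 := by positivity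
  rw [abs_div, abs_of_pos hn, lt_div_iff₀ hn]
  by_contra hh
  exact hv (abs_le.1 (not_lt.1 hh))

lemma aPsi_supp (κ : ℝ → ℝ) (h2 : ∀ x, 2 ≤ |x| → κ x = 0) (t : ℝ) (n : ℕ) :
    HasCompactSupport (aPsi κ t n) := by
  refine HasCompactSupport.intro (isCompact_Icc (a := -(2 * ((n:ℝ) + 1))) (b := 2 * ((n:ℝ) + 1))) ?_
  intro v hv
  rw [aPsi, h2 _ (cut_zero κ h2 n v hv).le, mul_zero]

lemma aPsi_le (κ : ℝ → ℝ) (h1 : ∀ x, 0 ≤ κ x ∧ κ x ≤ 1) (t : ℝ) (n : ℕ) (v : ℝ) :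
    |aPsi κ t n v| ≤ |gG t v| := by
  rw [aPsi, abs_mul, gG_abs, abs_of_nonneg (h1 _).1]
  have := gE_diff_le t (n + 1 / Real.sqrt t) v (by simp)
  calc _ ≤ |gE ((n + 1 / Real.sqrt t) * v) - gE (v / Real.sqrt t)| * 1 :=
        mul_le_mul_of_nonneg_left (h1 _).2 (abs_nonneg _)
    _ ≤ _ := by rw [mul_one]; exact this

lemma cut_ev (κ : ℝ → ℝ) (hk : ∀ x, |x| ≤ 1 → κ x = 1) (v : ℝ) :
    ∀ᶠ n : ℕ in Filter.atTop, κ (v / ((n:ℝ) + 1)) = 1 := by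
  filter_upwards [Filter.eventually_ge_atTop ⌈|v|⌉₊] with n hn
  apply hk
  have hn0 : (0:ℝ) < (n:ℝ) + 1 := by positivity
  rw [abs_div, abs_of_pos hn0, div_le_one hn0]
  have := Nat.ceil_le.1 hn
  linarith

lemma aPsi_tendsto (κ : ℝ → ℝ) (hk : ∀ x, |x| ≤ 1 → κ x = 1) (t v : ℝ) (hv : v ≠ 0) :
    Filter.Tendsto (fun n => aPsi κ t n v) Filter.atTop (nhds (gG t v)) := by
  have hm : Filter.Tendsto (fun n : ℕ => (n:ℝ) + 1 / Real.sqrt t) Filter.atTop Filter.atTop :=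
    Filter.tendsto_atTop_add_const_right _ _ tendsto_natCast_atTop_atTop
  have key : Filter.Tendsto (fun n : ℕ => gE ((n + 1 / Real.sqrt t) * v) - gE (v / Real.sqrt t))
      Filter.atTop (nhds (gG t v)) := by
    rcases lt_or_gt_of_ne hv with h | h
    · have h1 := (gE_tendsto.comp (hm.atTop_mul_const (by linarith : 0 < -v))).neg
      have h2 := h1.sub_const (gE (v / Real.sqrt t))
      have e : -(1/2) - gE (v / Real.sqrt t) = gG t v := by
        simp only [gG, if_neg (not_le.2 h), abs_of_neg h, gQ, neg_div, gE_neg]; ring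
      rw [e] at h2
      refine h2.congr (fun n => ?_)
      simp only [Function.comp, mul_neg, gE_neg, neg_neg]
    · have h1 := (gE_tendsto.comp (hm.atTop_mul_const h))
      have h2 := h1.sub_const (gE (v / Real.sqrt t))
      have e : (1/2) - gE (v / Real.sqrt t) = gG t v := by
        simp only [gG, if_pos h.le, abs_of_pos h, gQ]; ring
      rw [e] at h2
      exact h2
  refine key.congr' ?_
  filter_upwards [cut_ev κ hk v] with n hn
  rw [aPsi, hn, mul_one]

lemma aPsi_pair (κ : ℝ → ℝ) (hκ : ContDiff ℝ (⊤ : ℕ∞) κ) (h1 : ∀ x, 0 ≤ κ x ∧ κ x ≤ 1)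
    (hk : ∀ x, |x| ≤ 1 → κ x = 1) (t : ℝ) (ht : 0 < t) :
    Filter.Tendsto (fun n => ∫ v, gG t v * aPsi κ t n v) Filter.atTop (nhds (∫ v, gG t v ^ 2)) := by
  refine tendsto_integral_of_dominated_convergence (fun v => gG t v ^ 2) (fun n => ?_)
    (gG_sq_integrable t ht) (fun n => ?_) ?_
  · exact (gG_meas t).aestronglyMeasurable.mul (aPsi_contDiff κ hκ t n).continuous.aestronglyMeasurable
  · filter_upwards with v
    rw [norm_mul, ← sq_abs, sq]
    exact mul_le_mul_of_nonneg_left (aPsi_le κ h1 t n v) (abs_nonneg _)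
  · have hne : ∀ᵐ v : ℝ, v ≠ 0 := by simp [ae_iff, measure_singleton]
    filter_upwards [hne] with v hv
    rw [sq]
    exact (aPsi_tendsto κ hk t v hv).const_mul _

lemma aPsi_sq (κ : ℝ → ℝ) (h1 : ∀ x, 0 ≤ κ x ∧ κ x ≤ 1) (t : ℝ) (ht : 0 < t) (n : ℕ) :
    ∫ v, aPsi κ t n v ^ 2 ≤ ∫ v, gG t v ^ 2 := by
  refine integral_mono_of_nonneg ?_ (gG_sq_integrable t ht) ?_
  · filter_upwards with v; exact sq_nonneg _
  · filter_upwards with v; exact sq_le_sq.2 (aPsi_le κ h1 t n v)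

lemma aH_contDiff (κ θ : ℝ → ℝ) (hκ : ContDiff ℝ (⊤ : ℕ∞) κ) (hθ : ContDiff ℝ (⊤ : ℕ∞) θ)
    (t δ : ℝ) (hδ : 0 < δ) (h0 : ∀ s, t - δ ≤ s → θ s = 0) (n : ℕ) :
    ContDiff ℝ (⊤ : ℕ∞) (aH κ θ t n) := by
  rw [contDiff_iff_contDiffAt]
  intro q
  by_cases hq : q.1 < t
  · unfold aH
    refine ContDiffAt.mul (hθ.contDiffAt.comp q contDiffAt_fst)
      (ContDiffAt.mul (gE_contDiff.contDiffAt.comp q ?_) (hκ.contDiffAt.comp q ?_))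
    · refine ContDiffAt.div contDiffAt_snd (ContDiffAt.sqrt ?_ ?_) ?_
      · exact contDiffAt_const.sub contDiffAt_fst
      · exact (sub_pos.2 hq).ne'
      · exact (Real.sqrt_pos.2 (sub_pos.2 hq)).ne'
    · exact contDiffAt_snd.div_const _
  · have : aH κ θ t n =ᶠ[nhds q] fun _ => 0 := by
      have : ∀ᶠ p : ℝ × ℝ in nhds q, t - δ < p.1 :=
        continuous_fst.continuousAt.eventually (lt_mem_nhds (by linarith [not_lt.1 hq]))
      filter_upwards [this] with p hp
      rw [aH, h0 _ hp.le, zero_mul]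
    exact contDiffAt_const.congr_of_eventuallyEq this

lemma aH_supp (κ θ : ℝ → ℝ) (h2 : ∀ x, 2 ≤ |x| → κ x = 0) (t δ : ℝ)
    (h0 : ∀ s, t - δ ≤ s → θ s = 0) (h0' : ∀ s, s ≤ δ → θ s = 0) (n : ℕ) :
    HasCompactSupport (aH κ θ t n) := by
  refine HasCompactSupport.intro ((isCompact_Icc (a := δ) (b := t - δ)).prod
    (isCompact_Icc (a := -(2 * ((n:ℝ) + 1))) (b := 2 * ((n:ℝ) + 1)))) ?_
  intro q hq
  by_cases h : q.1 ∈ Set.Icc δ (t - δ)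
  · have hv : q.2 ∉ Set.Icc (-(2 * ((n:ℝ) + 1))) (2 * ((n:ℝ) + 1)) := fun hh => hq ⟨h, hh⟩
    rw [aH, h2 _ (cut_zero κ h2 n q.2 hv).le, mul_zero, mul_zero]
  · have : θ q.1 = 0 := by
      by_cases h1 : δ ≤ q.1
      · exact h0 _ (le_of_lt (lt_of_not_ge fun h3 => h ⟨h1, h3⟩))
      · exact h0' _ (not_le.1 h1).le
    rw [aH, this, zero_mul]

lemma aH_deriv (κ θ : ℝ → ℝ) (hκ : ContDiff ℝ (⊤ : ℕ∞) κ) (t : ℝ) (n : ℕ) (s u : ℝ) (hs : s < t) :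
    deriv (fun u => aH κ θ t n (s, u)) u =
      θ s * (heatK (t - s) u * κ (u / (n + 1)) +
        gE (u / Real.sqrt (t - s)) * (deriv κ (u / (n + 1)) / (n + 1))) := by
  have hp : 0 < t - s := sub_pos.2 hs
  have h1 : HasDerivAt (fun u => gE (u / Real.sqrt (t - s))) (heatK (t - s) u) u := by
    rw [heatK_eq _ _ hp]
    have := (gE_hasDerivAt (u / Real.sqrt (t - s))).comp u ((hasDerivAt_id u).div_const (Real.sqrt (t - s)))
    refine this.congr_deriv ?_
    ring
  have h2 : HasDerivAt (fun u => κ (u / ((n:ℝ) + 1))) (deriv κ (u / (n + 1)) / (n + 1)) u := by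
    have := (((hκ.differentiable (by simp)) (u / ((n:ℝ) + 1))).hasDerivAt).comp u
      ((hasDerivAt_id u).div_const ((n:ℝ) + 1))
    refine this.congr_deriv ?_
    ring
  exact ((h1.mul h2).const_mul (θ s)).deriv

lemma aH_deriv_zero (κ θ : ℝ → ℝ) (t : ℝ) (n : ℕ) (s u : ℝ) (hs : θ s = 0) :
    deriv (fun u => aH κ θ t n (s, u)) u = 0 := by
  simp [aH, hs]

section bounds

variable (κ θ : ℝ → ℝ) (C : ℝ) (hκ : ContDiff ℝ (⊤ : ℕ∞) κ) (h1 : ∀ x, 0 ≤ κ x ∧ κ x ≤ 1)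
  (h2 : ∀ x, 2 ≤ |x| → κ x = 0) (hC : 0 ≤ C) (hd : ∀ x, |deriv κ x| ≤ C)
  (hd0 : ∀ x, 2 < |x| → deriv κ x = 0) (hθ : ∀ x, 0 ≤ θ x ∧ θ x ≤ 1)
  (t : ℝ) (n : ℕ) (s : ℝ) (hs : s < t)

lemma aH_second (hC : 0 ≤ C) (hd : ∀ x, |deriv κ x| ≤ C) (u : ℝ) :
    |gE (u / Real.sqrt (t - s)) * (deriv κ (u / (n + 1)) / (n + 1))| ≤ C / (n + 1) := by
  have hn : (0:ℝ) < (n:ℝ) + 1 := by positivity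
  rw [abs_mul, abs_div, abs_of_pos hn]
  have a := gE_abs (u / Real.sqrt (t - s))
  have b : |deriv κ (u / (n + 1))| / ((n:ℝ) + 1) ≤ C / (n + 1) :=
    div_le_div_of_nonneg_right (hd _) hn.le
  calc _ ≤ 1 * (C / ((n:ℝ) + 1)) := mul_le_mul (by linarith) b (by positivity) (by norm_num)
    _ = _ := one_mul _

lemma aH_deriv_bound (hκ : ContDiff ℝ (⊤ : ℕ∞) κ) (h1 : ∀ x, 0 ≤ κ x ∧ κ x ≤ 1)
    (h2 : ∀ x, 2 ≤ |x| → κ x = 0) (hC : 0 ≤ C) (hd : ∀ x, |deriv κ x| ≤ C)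
    (hd0 : ∀ x, 2 < |x| → deriv κ x = 0) (hθ : ∀ x, 0 ≤ θ x ∧ θ x ≤ 1) (hs : s < t) (u : ℝ) :
    |deriv (fun u => aH κ θ t n (s, u)) u| ≤ heatK (t - s) u +
      (Set.Icc (-(2 * ((n:ℝ) + 1))) (2 * ((n:ℝ) + 1))).indicator (fun _ => C / ((n:ℝ) + 1)) u := by
  rw [aH_deriv κ θ hκ t n s u hs, abs_mul, abs_of_nonneg (hθ s).1]
  have hp := heatK_nonneg (t - s) u
  have a1 : |heatK (t - s) u * κ (u / (n + 1))| ≤ heatK (t - s) u := by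
    rw [abs_mul, abs_of_nonneg hp, abs_of_nonneg (h1 _).1]
    exact mul_le_of_le_one_right hp (h1 _).2
  have a2 : |gE (u / Real.sqrt (t - s)) * (deriv κ (u / (n + 1)) / (n + 1))| ≤
      (Set.Icc (-(2 * ((n:ℝ) + 1))) (2 * ((n:ℝ) + 1))).indicator (fun _ => C / ((n:ℝ) + 1)) u := by
    by_cases hu : u ∈ Set.Icc (-(2 * ((n:ℝ) + 1))) (2 * ((n:ℝ) + 1))
    · rw [Set.indicator_of_mem hu]
      exact aH_second κ C t n s hC hd u
    · rw [Set.indicator_of_notMem hu, hd0 _ (cut_zero κ h2 n u hu)]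
      simp
  calc _ ≤ 1 * |heatK (t - s) u * κ (u / (n + 1)) +
        gE (u / Real.sqrt (t - s)) * (deriv κ (u / (n + 1)) / (n + 1))| :=
        mul_le_mul_of_nonneg_right (hθ s).2 (abs_nonneg _)
    _ ≤ _ := by rw [one_mul]; exact (abs_add_le _ _).trans (add_le_add a1 a2)

lemma aH_sq_le (hκ : ContDiff ℝ (⊤ : ℕ∞) κ) (h1 : ∀ x, 0 ≤ κ x ∧ κ x ≤ 1)
    (h2 : ∀ x, 2 ≤ |x| → κ x = 0) (hC : 0 ≤ C) (hd : ∀ x, |deriv κ x| ≤ C)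
    (hd0 : ∀ x, 2 < |x| → deriv κ x = 0) (hθ : ∀ x, 0 ≤ θ x ∧ θ x ≤ 1) (hs : s < t) :
    ∫ u, deriv (fun u => aH κ θ t n (s, u)) u ^ 2 ≤
      (∫ u, heatK (t - s) u ^ 2) + (2 * C + 4 * C ^ 2) / (n + 1) := by
  have hp : 0 < t - s := sub_pos.2 hs
  have hn : (0:ℝ) < (n:ℝ) + 1 := by positivity
  set S := Set.Icc (-(2 * ((n:ℝ) + 1))) (2 * ((n:ℝ) + 1)) with hS
  set b := C / ((n:ℝ) + 1) with hb
  have hb0 : 0 ≤ b := by positivity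
  have i1 := heatK_sq_integrable (t - s) hp
  have i2 := (heatK_integrable (t - s) hp).const_mul (2 * b)
  have i3 : Integrable (S.indicator (fun _ => b ^ 2)) := by
    rw [integrable_indicator_iff measurableSet_Icc]
    simp [hS]
  have e3 : ∫ u, S.indicator (fun _ => b ^ 2) u = 4 * C ^ 2 / (n + 1) := by
    rw [integral_indicator measurableSet_Icc]
    simp only [hS, integral_const, MeasurableSet.univ, measureReal_restrict_apply, Set.univ_inter,
      Real.volume_real_Icc, smul_eq_mul, hb]
    rw [max_eq_left (by linarith)]
    field_simp
    ring
  calc _ ≤ ∫ u, (heatK (t - s) u ^ 2 + 2 * b * heatK (t - s) u + S.indicator (fun _ => b ^ 2) u) := by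
        refine integral_mono_of_nonneg ?_ ((i1.add i2).add i3) ?_
        · filter_upwards with u; exact sq_nonneg _
        · filter_upwards with u
          have := aH_deriv_bound κ θ C t n s hκ h1 h2 hC hd hd0 hθ hs u
          have hk := heatK_nonneg (t - s) u
          rw [← sq_abs]
          by_cases hu : u ∈ S
          · rw [Set.indicator_of_mem hu] at this ⊢
            have := pow_le_pow_left₀ (abs_nonneg _) this 2
            refine this.trans (le_of_eq ?_)
            ring
          · rw [Set.indicator_of_notMem hu] at this ⊢
            have := pow_le_pow_left₀ (abs_nonneg _) this 2
            refine this.trans ?_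
            rw [add_zero, add_zero]
            linarith [mul_nonneg (mul_nonneg zero_le_two hb0) hk]
    _ = _ := by
        have i12 : Integrable (fun u => heatK (t - s) u ^ 2 + 2 * b * heatK (t - s) u) := i1.add i2
        rw [integral_add i12 i3, integral_add i1 i2, integral_const_mul, heatK_integral _ hp, e3, hb]
        ring

lemma aH_pair_bound (hκ : ContDiff ℝ (⊤ : ℕ∞) κ) (h1 : ∀ x, 0 ≤ κ x ∧ κ x ≤ 1)
    (h2 : ∀ x, 2 ≤ |x| → κ x = 0) (hC : 0 ≤ C) (hd : ∀ x, |deriv κ x| ≤ C)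
    (hd0 : ∀ x, 2 < |x| → deriv κ x = 0) (hθ : ∀ x, 0 ≤ θ x ∧ θ x ≤ 1) (hs : s < t) (u : ℝ) :
    ‖heatK (t - s) u * deriv (fun u => aH κ θ t n (s, u)) u‖ ≤
      heatK (t - s) u ^ 2 + C * heatK (t - s) u := by
  have hn : (0:ℝ) < (n:ℝ) + 1 := by positivity
  have hk := heatK_nonneg (t - s) u
  rw [norm_mul, Real.norm_eq_abs, Real.norm_eq_abs, abs_of_nonneg hk]
  have := aH_deriv_bound κ θ C t n s hκ h1 h2 hC hd hd0 hθ hs u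
  have h3 : (Set.Icc (-(2 * ((n:ℝ) + 1))) (2 * ((n:ℝ) + 1))).indicator (fun _ => C / ((n:ℝ) + 1)) u ≤ C := by
    apply Set.indicator_apply_le' 
    · intro _
      exact div_le_self hC (by linarith [(Nat.cast_nonneg n : (0:ℝ) ≤ n)])
    · intro _; exact hC
  have := mul_le_mul_of_nonneg_left (this.trans (add_le_add_right h3 _)) hk
  refine this.trans (le_of_eq ?_)
  ring

end bounds

lemma aH_pair (κ : ℝ → ℝ) (θ : ℕ → ℝ → ℝ) (C : ℝ) (hκ : ContDiff ℝ (⊤ : ℕ∞) κ)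
    (h1 : ∀ x, 0 ≤ κ x ∧ κ x ≤ 1) (hk : ∀ x, |x| ≤ 1 → κ x = 1)
    (h2 : ∀ x, 2 ≤ |x| → κ x = 0) (hC : 0 ≤ C) (hd : ∀ x, |deriv κ x| ≤ C)
    (hd0 : ∀ x, 2 < |x| → deriv κ x = 0) (hθ : ∀ n x, 0 ≤ θ n x ∧ θ n x ≤ 1)
    (t : ℝ) (ht : 0 < t)
    (hc : ∀ n, Continuous fun q : ℝ × ℝ => deriv (fun u => aH κ (θ n) t n (q.1, u)) q.2)
    (hlim : ∀ s, 0 < s → s < t → ∀ᶠ n in Filter.atTop, θ n s = 1) :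
    Filter.Tendsto (fun n => ∫ s in (0:ℝ)..t, ∫ u, heatK (t - s) u *
        deriv (fun u => aH κ (θ n) t n (s, u)) u) Filter.atTop
      (nhds (∫ s in (0:ℝ)..t, ∫ u, heatK (t - s) u ^ 2)) := by
  have hne : ∀ᵐ v : ℝ, v ≠ t := by simp [ae_iff, measure_singleton]
  have hm : ∀ n, Measurable (fun q : ℝ × ℝ => heatK (t - q.1) q.2 *
      deriv (fun u => aH κ (θ n) t n (q.1, u)) q.2) := fun n =>
    (heatK_meas.comp (by fun_prop : Measurable fun q : ℝ × ℝ => (t - q.1, q.2))).mul (hc n).measurable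
  have hI : ∀ s, s < t → Integrable (fun u => heatK (t - s) u ^ 2 + C * heatK (t - s) u) := fun s hs =>
    (heatK_sq_integrable _ (sub_pos.2 hs)).add ((heatK_integrable _ (sub_pos.2 hs)).const_mul C)
  refine intervalIntegral.tendsto_integral_filter_of_dominated_convergence
    (fun s => (∫ u, heatK (t - s) u ^ 2) + C) ?_ ?_ ?_ ?_
  · filter_upwards with n
    exact ((hm n).stronglyMeasurable.integral_prod_right (ν := volume)).aestronglyMeasurable
  · filter_upwards with n
    filter_upwards [hne] with s hs1 hs
    rw [Set.uIoc_of_le ht.le] at hs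
    have hst : s < t := lt_of_le_of_ne hs.2 hs1
    refine (norm_integral_le_of_norm_le (hI s hst) (Filter.Eventually.of_forall fun u =>
      aH_pair_bound κ (θ n) C t n s hκ h1 h2 hC hd hd0 (hθ n) hst u)).trans ?_
    rw [integral_add (heatK_sq_integrable _ (sub_pos.2 hst))
      ((heatK_integrable _ (sub_pos.2 hst)).const_mul C), integral_const_mul,
      heatK_integral _ (sub_pos.2 hst), mul_one]
  · exact (Kp_ii t ht).1.add intervalIntegrable_const
  · filter_upwards [hne] with s hs1 hs
    rw [Set.uIoc_of_le ht.le] at hs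
    have hst : s < t := lt_of_le_of_ne hs.2 hs1
    refine tendsto_integral_of_dominated_convergence _ (fun n => ?_) (hI s hst)
      (fun n => Filter.Eventually.of_forall fun u =>
        aH_pair_bound κ (θ n) C t n s hκ h1 h2 hC hd hd0 (hθ n) hst u) ?_
    · exact ((hm n).comp (measurable_prodMk_left (x := s))).aestronglyMeasurable
    · filter_upwards with u
      rw [sq]
      apply Filter.Tendsto.const_mul
      have hz : Filter.Tendsto (fun n : ℕ => gE (u / Real.sqrt (t - s)) * (deriv κ (u / (n + 1)) / (n + 1)))
          Filter.atTop (nhds 0) := by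
        refine squeeze_zero_norm (fun n => aH_second κ C t n s hC hd u) ?_
        exact (tendsto_const_div_atTop_nhds_zero_nat C).comp (Filter.tendsto_add_atTop_nat 1) |>.congr
          (fun n => by simp)
      have := hz.const_add (heatK (t - s) u)
      rw [add_zero] at this
      refine this.congr' ?_
      filter_upwards [cut_ev κ hk u, hlim s hs.1 hst] with n hn1 hn2
      rw [aH_deriv κ (θ n) hκ t n s u hst, hn1, hn2, one_mul, mul_one]

lemma Adm.ii {ψ : ℝ → ℝ} {H : ℝ → ℝ → ℝ} (h : Adm ψ H) :
    Integrable (fun s => ∫ u, deriv (H s) u ^ 2) := by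
  obtain ⟨h1, h2, h3, h4, h5, h6, h7, h8, h9⟩ := h
  have iD2 : Integrable (fun q : ℝ × ℝ => deriv (H q.1) q.2 ^ 2) (volume.prod volume) :=
    (h6.pow 2).integrable_of_hasCompactSupport (supp_sq (deriv_supp H h9))
  exact iD2.integral_prod_left

lemma approx (t T : ℝ) (ht : 0 < t) (htT : t ≤ T) : ∃ (ψ : ℕ → ℝ → ℝ) (H : ℕ → ℝ × ℝ → ℝ) (C : ℝ),
    (∀ n, ContDiff ℝ (⊤ : ℕ∞) (ψ n) ∧ HasCompactSupport (ψ n) ∧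
      ContDiff ℝ (⊤ : ℕ∞) (H n) ∧ HasCompactSupport (H n)) ∧
    (∀ n, ∫ v, ψ n v ^ 2 ≤ ∫ v, gG t v ^ 2) ∧
    (∀ n : ℕ, ∫ s in (0:ℝ)..T, ∫ u, deriv (fun u => H n (s, u)) u ^ 2 ≤
      (∫ s in (0:ℝ)..t, ∫ u, heatK (t - s) u ^ 2) + C / (n + 1)) ∧
    Filter.Tendsto (fun n => ∫ v, gG t v * ψ n v) Filter.atTop (nhds (∫ v, gG t v ^ 2)) ∧
    Filter.Tendsto (fun n => ∫ s in (0:ℝ)..t, ∫ u, heatK (t - s) u *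
        deriv (fun u => H n (s, u)) u) Filter.atTop
      (nhds (∫ s in (0:ℝ)..t, ∫ u, heatK (t - s) u ^ 2)) := by
  obtain ⟨κ, C, hκ, h1, hk, h2, hC, hd, hd0⟩ := exists_cut
  have hδ : ∀ n : ℕ, 0 < t / ((n:ℝ) + 8) := fun n => by positivity
  have hδt : ∀ n : ℕ, 4 * (t / ((n:ℝ) + 8)) < t := fun n => by
    rw [← mul_div_assoc, div_lt_iff₀ (by positivity)]
    have : (0:ℝ) ≤ n := Nat.cast_nonneg n
    nlinarith
  choose θ t1 t2 t3 t4 t5 using fun n : ℕ => exists_theta t _ (hδ n) (hδt n)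
  have hcd : ∀ n, ContDiff ℝ (⊤ : ℕ∞) (aH κ (θ n) t n) := fun n =>
    aH_contDiff κ (θ n) hκ (t1 n) t _ (hδ n) (t5 n) n
  have hcs : ∀ n, HasCompactSupport (aH κ (θ n) t n) := fun n => aH_supp κ (θ n) h2 t _ (t5 n) (t4 n) n
  have hadm : ∀ n, Adm (aPsi κ t n) (fun r u => aH κ (θ n) t n (r, u)) := fun n =>
    adm_of_contDiff _ (aPsi_contDiff κ hκ t n) (aPsi_supp κ h2 t n) _ (hcd n) (hcs n)
  refine ⟨aPsi κ t, fun n => aH κ (θ n) t n, t * (2 * C + 4 * C ^ 2), fun n =>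
    ⟨aPsi_contDiff κ hκ t n, aPsi_supp κ h2 t n, hcd n, hcs n⟩, aPsi_sq κ h1 t ht, fun n => ?_,
    aPsi_pair κ hκ h1 hk t ht, ?_⟩
  · have hI := (hadm n).ii
    rw [← intervalIntegral.integral_add_adjacent_intervals (b := t) hI.intervalIntegrable hI.intervalIntegrable]
    have hz : ∫ s in t..T, ∫ u, deriv (fun u => aH κ (θ n) t n (s, u)) u ^ 2 = 0 := by
      have : ∫ s in t..T, ∫ u, deriv (fun u => aH κ (θ n) t n (s, u)) u ^ 2 = ∫ s in t..T, (0:ℝ) := by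
        apply intervalIntegral.integral_congr
        intro s hs
        rw [Set.uIcc_of_le htT] at hs
        have h0 : θ n s = 0 := t5 n s (by linarith [hs.1, hδ n])
        simp only [aH_deriv_zero κ (θ n) t n s _ h0]
        simp
      rw [this]; simp
    rw [hz, add_zero]
    have hne : ∀ᵐ v : ℝ ∂(volume.restrict (Set.Icc 0 t)), v ≠ t :=
      ae_restrict_of_ae (by simp [ae_iff, measure_singleton])
    calc _ ≤ ∫ s in (0:ℝ)..t, ((∫ u, heatK (t - s) u ^ 2) + (2 * C + 4 * C ^ 2) / (n + 1)) := by
          refine intervalIntegral.integral_mono_ae_restrict ht.le hI.intervalIntegrable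
            ((Kp_ii t ht).1.add intervalIntegrable_const) ?_
          filter_upwards [hne, ae_restrict_mem measurableSet_Icc] with s hs1 hs2
          exact aH_sq_le κ (θ n) C t n s hκ h1 h2 hC hd hd0 (t2 n) (lt_of_le_of_ne hs2.2 hs1)
      _ = _ := by
          rw [intervalIntegral.integral_add (Kp_ii t ht).1 intervalIntegrable_const,
            intervalIntegral.integral_const]
          simp only [sub_zero, smul_eq_mul]
          ring
  · refine aH_pair κ θ C hκ h1 hk h2 hC hd hd0 t2 t ht (fun n => (hadm n).2.2.2.2.2.1) ?_
    intro s hs0 hst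
    have hlim : Filter.Tendsto (fun n : ℕ => 2 * (t / ((n:ℝ) + 8))) Filter.atTop (nhds 0) := by
      have := ((tendsto_const_div_atTop_nhds_zero_nat t).comp (Filter.tendsto_add_atTop_nat 8)).const_mul 2
      rw [mul_zero] at this
      exact this.congr (fun n => by simp)
    filter_upwards [hlim.eventually (gt_mem_nhds hs0), hlim.eventually (gt_mem_nhds (sub_pos.2 hst))] with n a b
    exact t3 n s a.le (by linarith)

lemma K_val (t : ℝ) (ht : 0 < t) : (∫ v, gG t v ^ 2) + (∫ s in (0:ℝ)..t, ∫ u, heatK (t - s) u ^ 2) =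
    2 * Real.sqrt t / Real.sqrt (2 * π) := by
  rw [gG_sq_integral t ht, (Kp_ii t ht).2]
  have : Real.sqrt π ≠ 0 := by positivity
  have : Real.sqrt (2 * π) ≠ 0 := by positivity
  field_simp
  ring

lemma upper (T χ α t : ℝ) (hχ : 0 < χ) (ht : 0 < t) (htT : t ≤ T) (K : ℝ) (hK : 0 < K)
    (hKe : (∫ v, gG t v ^ 2) + (∫ s in (0:ℝ)..t, ∫ u, heatK (t - s) u ^ 2) = K) :
    ∃ y b : ℕ → ℝ, Filter.Tendsto b Filter.atTop (nhds (α ^ 2 / (2 * χ * K))) ∧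
      ∀ᶠ n in Filter.atTop, y n ≤ b n ∧ ∃ ψ : ℝ → ℝ, ∃ H : ℝ → ℝ → ℝ, Adm ψ H ∧
        netCurrent χ t ψ H = α ∧
        y n = (∫ u, (ψ u) ^ 2) / (2 * χ) + (χ / 2) * ∫ r in (0:ℝ)..T, ∫ u, (deriv (H r) u) ^ 2 := by
  obtain ⟨ψ, H, C, hs, e1, e2, l1, l2⟩ := approx t T ht htT
  set P : ℕ → ℝ := fun n => (∫ v, gG t v * ψ n v) + ∫ s in (0:ℝ)..t, ∫ u, heatK (t - s) u *
        deriv (fun u => H n (s, u)) u with hP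
  have hPl : Filter.Tendsto P Filter.atTop (nhds K) := by
    rw [← hKe]; exact l1.add l2
  have hCl : Filter.Tendsto (fun n : ℕ => C / ((n:ℝ) + 1)) Filter.atTop (nhds 0) := by
    exact ((tendsto_const_div_atTop_nhds_zero_nat C).comp (Filter.tendsto_add_atTop_nat 1)).congr
          (fun n => by simp)
  refine ⟨fun n => (∫ u, (α / (χ * P n) * χ * ψ n u) ^ 2) / (2 * χ) + (χ / 2) *
      ∫ r in (0:ℝ)..T, ∫ u, (deriv (fun u => α / (χ * P n) * H n (r, u)) u) ^ 2,
    fun n => α ^ 2 / (2 * χ) * ((K + C / (n + 1)) / P n ^ 2), ?_, ?_⟩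
  · have := (((hCl.const_add K).div (hPl.pow 2) (by positivity))).const_mul (α ^ 2 / (2 * χ))
    have e : α ^ 2 / (2 * χ) * ((K + 0) / K ^ 2) = α ^ 2 / (2 * χ * K) := by field_simp; ring
    rw [e] at this
    exact this
  · filter_upwards [hPl.eventually (lt_mem_nhds hK)] with n hn
    obtain ⟨s1, s2, s3, s4⟩ := hs n
    set c := α / (χ * P n) with hc
    have hadm : Adm (fun u => c * χ * ψ n u) (fun r u => c * H n (r, u)) :=
      adm_of_contDiff _ (contDiff_const.mul s1) s2.mul_left (fun q => c * H n q)
        (contDiff_const.mul s3) s4.mul_left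
    refine ⟨?_, _, _, hadm, ?_, rfl⟩
    · simp only [deriv_const_mul_field, mul_pow]
      simp only [integral_const_mul, intervalIntegral.integral_const_mul]
      have h1 := e1 n
      have h2 := e2 n
      generalize (∫ v, ψ n v ^ 2) = x at *
      generalize (∫ s in (0:ℝ)..T, ∫ u, deriv (fun u => H n (s, u)) u ^ 2) = z at *
      have e : α ^ 2 / (2 * χ) * ((K + C / (n + 1)) / P n ^ 2) = c ^ 2 * χ / 2 * (K + C / (n + 1)) := by
        rw [hc]; field_simp
      have e' : c ^ 2 * χ ^ 2 * x / (2 * χ) + χ / 2 * (c ^ 2 * z) = c ^ 2 * χ / 2 * (x + z) := by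
        field_simp
      rw [e, e']
      refine mul_le_mul_of_nonneg_left ?_ (by positivity)
      linarith
    · rw [hadm.current χ t ht]
      simp only [deriv_const_mul_field]
      have q1 : ∀ v, gG t v * (c * χ * ψ n v) = c * χ * (gG t v * ψ n v) := fun v => by ring
      have q2 : ∀ s u, heatK (t - s) u * (c * deriv (fun u => H n (s, u)) u) =
        c * (heatK (t - s) u * deriv (fun u => H n (s, u)) u) := fun s u => by ring
      simp only [q1, q2, integral_const_mul, intervalIntegral.integral_const_mul]
      have : c * χ * P n = α := by rw [hc]; field_simp
      rw [← this, hP]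
      ring

/-- For `0 < t ≤ T`, the infimum of `‖ψ‖²_{L²}/(2χ) + (χ/2)∫₀ᵀ∫(∂_u H)²` over
`ψ ∈ C²_c(ℝ)` and `H ∈ C^{1,2}_c([0,T]×ℝ)` with `𝒞(t; ψ, H) = α` equals
`√(2π) α²/(4χ√t)`. -/
theorem rate_inf_current_at_t (T ρ χ α t : ℝ) (hT : 0 < T) (hρ : ρ ∈ Set.Ioo (0:ℝ) 1)
    (hχ : χ = ρ * (1 - ρ)) (htpos : 0 < t) (htT : t ≤ T) :
    sInf {y : ℝ | ∃ ψ : ℝ → ℝ, ∃ H : ℝ → ℝ → ℝ,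
        ContDiff ℝ 2 ψ ∧ HasCompactSupport ψ ∧
        (∀ u, ContDiff ℝ 1 fun r => H r u) ∧
        (∀ r, ContDiff ℝ 2 fun u => H r u) ∧
        (Continuous fun q : ℝ × ℝ => deriv (fun r => H r q.2) q.1) ∧
        (Continuous fun q : ℝ × ℝ => deriv (H q.1) q.2) ∧
        (Continuous fun q : ℝ × ℝ => deriv (deriv (H q.1)) q.2) ∧
        (Continuous fun q : ℝ × ℝ => H q.1 q.2) ∧
        (HasCompactSupport fun q : ℝ × ℝ => H q.1 q.2) ∧
        netCurrent χ t ψ H = α ∧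
        y = (∫ u, (ψ u) ^ 2) / (2 * χ) +
          (χ / 2) * ∫ r in (0:ℝ)..T, ∫ u, (deriv (H r) u) ^ 2} =
      Real.sqrt (2 * π) * α ^ 2 / (4 * χ * Real.sqrt t) := by
  have hχ0 : 0 < χ := by
    rw [hχ]; exact mul_pos hρ.1 (by linarith [hρ.2])
  set K := 2 * Real.sqrt t / Real.sqrt (2 * π) with hKd
  have hK : 0 < K := by positivity
  have hval : Real.sqrt (2 * π) * α ^ 2 / (4 * χ * Real.sqrt t) = α ^ 2 / (2 * χ * K) := by
    rw [hKd]
    have : Real.sqrt t ≠ 0 := by positivity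
    have : Real.sqrt (2 * π) ≠ 0 := by positivity
    field_simp
    ring
  rw [hval]
  have hlow : ∀ ψ H, Adm ψ H → netCurrent χ t ψ H = α → α ^ 2 / (2 * χ * K) ≤
      (∫ u, (ψ u) ^ 2) / (2 * χ) + (χ / 2) * ∫ r in (0:ℝ)..T, ∫ u, (deriv (H r) u) ^ 2 := by
    intro ψ H h hcur
    have := h.lower χ t T (α / (χ * K)) hχ0 htpos htT
    rw [hcur, K_val t htpos, ← hKd] at this
    refine le_trans (le_of_eq ?_) this
    field_simp
    ring
  obtain ⟨y, b, hb, hy⟩ := upper T χ α t hχ0 htpos htT K hK (K_val t htpos)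
  have hmem : ∀ᶠ n in Filter.atTop, y n ≤ b n ∧ y n ∈ {y : ℝ | ∃ ψ : ℝ → ℝ, ∃ H : ℝ → ℝ → ℝ,
        ContDiff ℝ 2 ψ ∧ HasCompactSupport ψ ∧
        (∀ u, ContDiff ℝ 1 fun r => H r u) ∧
        (∀ r, ContDiff ℝ 2 fun u => H r u) ∧
        (Continuous fun q : ℝ × ℝ => deriv (fun r => H r q.2) q.1) ∧
        (Continuous fun q : ℝ × ℝ => deriv (H q.1) q.2) ∧
        (Continuous fun q : ℝ × ℝ => deriv (deriv (H q.1)) q.2) ∧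
        (Continuous fun q : ℝ × ℝ => H q.1 q.2) ∧
        (HasCompactSupport fun q : ℝ × ℝ => H q.1 q.2) ∧
        netCurrent χ t ψ H = α ∧
        y = (∫ u, (ψ u) ^ 2) / (2 * χ) +
          (χ / 2) * ∫ r in (0:ℝ)..T, ∫ u, (deriv (H r) u) ^ 2} := by
    filter_upwards [hy] with n hn
    obtain ⟨h1, ψ, H, ⟨a1, a2, a3, a4, a5, a6, a7, a8, a9⟩, h2, h3⟩ := hn
    exact ⟨h1, ψ, H, a1, a2, a3, a4, a5, a6, a7, a8, a9, h2, h3⟩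
  have hbelow : ∀ z ∈ {y : ℝ | ∃ ψ : ℝ → ℝ, ∃ H : ℝ → ℝ → ℝ,
        ContDiff ℝ 2 ψ ∧ HasCompactSupport ψ ∧
        (∀ u, ContDiff ℝ 1 fun r => H r u) ∧
        (∀ r, ContDiff ℝ 2 fun u => H r u) ∧
        (Continuous fun q : ℝ × ℝ => deriv (fun r => H r q.2) q.1) ∧
        (Continuous fun q : ℝ × ℝ => deriv (H q.1) q.2) ∧
        (Continuous fun q : ℝ × ℝ => deriv (deriv (H q.1)) q.2) ∧
        (Continuous fun q : ℝ × ℝ => H q.1 q.2) ∧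
        (HasCompactSupport fun q : ℝ × ℝ => H q.1 q.2) ∧
        netCurrent χ t ψ H = α ∧
        y = (∫ u, (ψ u) ^ 2) / (2 * χ) +
          (χ / 2) * ∫ r in (0:ℝ)..T, ∫ u, (deriv (H r) u) ^ 2}, α ^ 2 / (2 * χ * K) ≤ z := by
    rintro z ⟨ψ, H, a1, a2, a3, a4, a5, a6, a7, a8, a9, h2, h3⟩
    rw [h3]
    exact hlow ψ H ⟨a1, a2, a3, a4, a5, a6, a7, a8, a9⟩ h2
  apply le_antisymm
  · refine ge_of_tendsto hb ?_
    filter_upwards [hmem] with n hn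
    exact (csInf_le ⟨_, hbelow⟩ hn.2).trans hn.1
  · obtain ⟨n, hn⟩ := hmem.exists
    exact le_csInf ⟨_, hn.2⟩ hbelow
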